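/- arXiv:1901.08034 — 2 statements merged into one kernel-verified Lean document; each statement's English description precedes it below -/
import Mathlib

section
/- Let a⁰,a¹ : ℕ → ℂ² satisfy condition (A), conditions (C1)–(C5) and ‖a⁰₀‖ < 1; let B > 0, B₀ ∈ ℂ with |B₀|² = B, and C₁ ∈ ℂ with |C₁|² = B·(1 − ‖a⁰₀‖²) (so C₁ ≠ 0). Define C : {1,2,…} → ℂ by C(1) := C₁, C_{2^k} := −(B/conj(C₁))·⟨a⁰_k, a⁰₀⟩ for k ≥ 1, C_{2^k+1} := −(C₁·conj(B₀)/conj(C₁))·⟨a¹_{k−1}, a⁰₀⟩ for k ≥ 1, and, recursively, C_l := C_{2^{p−p₁}+1}·C_{l₁}/C₁ for every l ≥ 2 with l₁ := l mod 2^{⌊log₂ l⌋} ≥ 2, where p := ⌊log₂ l⌋ and p₁ := ⌊log₂ l₁⌋. Define Ψ : ℕ → ℂ² by Ψ₀ := 0, Ψ_{2^k} := B₀·a⁰_k for k ≥ 0, and Ψ_{2^{p+k+1}+l} := C_l·a¹_k for every l ≥ 1, p := ⌊log₂ l⌋ and k ≥ 0, and define h_l and β_{l,l'} from Ψ and B as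 in the Hardy reformulation. Then for all l,l' ≥ 0 and every σ ∈ ℤ: ∑_{k=max(0,−σ)}^{∞} ⟨h_{l'}(k), h_l(k+σ)⟩ = β_{l,l'} if σ = 0 and = 0 otherwise. -/
open Finset

/-- `ℂ²` with its Euclidean structure. -/
abbrev E2 := EuclideanSpace ℂ (Fin 2)

/-- The inner product of `ℂ²`: `⟨u,v⟩ = u⁽¹⁾conj(v⁽¹⁾) + u⁽²⁾conj(v⁽²⁾)`. -/
noncomputable def cinner (u v : E2) : ℂ := ∑ i, u i * (starRingEnd ℂ) (v i)

/-- Condition (A). -/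
def condA (a0 a1 : ℕ → E2) : Prop :=
  (∀ m : ℕ, (∑' k : ℕ, cinner (a0 (k + m)) (a0 k)) = if m = 0 then 1 else 0) ∧
  (∀ m : ℕ, (∑' k : ℕ, cinner (a1 (k + m)) (a1 k)) = if m = 0 then 1 else 0) ∧
  (∀ m : ℕ, (∑' k : ℕ, cinner (a0 (k + m)) (a1 k)) = 0) ∧
  (∀ m : ℕ, (∑' k : ℕ, cinner (a1 (k + m)) (a0 k)) = 0)

/-- Conditions (C1)–(C5), with `d := 1 − ‖a0 0‖²`. -/
def condC (a0 a1 : ℕ → E2) : Prop :=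
  (∀ p : ℕ, 1 ≤ p → ‖cinner (a0 p) (a0 0)‖ ^ 2
      = (1 - ‖a0 0‖ ^ 2) * (1 - ∑ k ∈ Finset.range (p + 1), ‖a0 k‖ ^ 2)) ∧
  (∀ p : ℕ, ‖cinner (a1 p) (a0 0)‖ ^ 2
      = (1 - ‖a0 0‖ ^ 2) * (1 - ∑ k ∈ Finset.range (p + 1), ‖a1 k‖ ^ 2)) ∧
  (∀ p p' : ℕ, 0 < p → p < p' →
    cinner (a0 p') (a0 0) * cinner (a0 0) (a0 p)
      = -((1 - ‖a0 0‖ ^ 2 : ℝ) : ℂ) *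
          ∑ r ∈ Finset.range (p + 1), cinner (a0 (p' - r)) (a0 (p - r))) ∧
  (∀ p p' : ℕ, p < p' →
    cinner (a1 p') (a0 0) * cinner (a0 0) (a1 p)
      = -((1 - ‖a0 0‖ ^ 2 : ℝ) : ℂ) *
          ∑ r ∈ Finset.range (p + 1), cinner (a1 (p' - r)) (a1 (p - r))) ∧
  (∀ p p' : ℕ, 0 < p → p ≤ p' →
    cinner (a1 p') (a0 0) * cinner (a0 0) (a0 p)
      = -((1 - ‖a0 0‖ ^ 2 : ℝ) : ℂ) *
          ∑ r ∈ Finset.range (p + 1), cinner (a1 (p' - r)) (a0 (p - r))) ∧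
  (∀ p p' : ℕ, p' < p →
    cinner (a1 p') (a0 0) * cinner (a0 0) (a0 p)
      = -((1 - ‖a0 0‖ ^ 2 : ℝ) : ℂ) *
          ∑ r ∈ Finset.range (p' + 1), cinner (a1 (p' - r)) (a0 (p - r)))

/-- The sequences `h_l : ℕ → ℂ²` of the Hardy reformulation. -/
noncomputable def hseq (Ψ : ℕ → E2) (l k : ℕ) : E2 :=
  if l = 0 then Ψ (2 ^ k) else Ψ (2 ^ (Nat.log 2 l + k + 1) + l)

/-- The constants `β_{l,l'}` of the Hardy reformulation. -/
noncomputable def betaC (Ψ : ℕ → E2) (B : ℝ) (l l' : ℕ) : ℂ :=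
  if l = 0 ∧ l' = 0 then (B : ℂ)
  else if l = 0 ∨ l' = 0 then 0
  else if l = l' then
    ((B - ∑ j ∈ Finset.range (Nat.log 2 l + 1), ‖Ψ (2 ^ j + l % 2 ^ j)‖ ^ 2 : ℝ) : ℂ)
  else - ∑ t ∈ Finset.range (min (Nat.log 2 l) (Nat.log 2 l') + 1),
    if l / 2 ^ (Nat.log 2 l - min (Nat.log 2 l) (Nat.log 2 l') + t)
       = l' / 2 ^ (Nat.log 2 l' - min (Nat.log 2 l) (Nat.log 2 l') + t) then
      cinner
        (Ψ (2 ^ (Nat.log 2 l' - min (Nat.log 2 l) (Nat.log 2 l') + t)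
           + l' % 2 ^ (Nat.log 2 l' - min (Nat.log 2 l) (Nat.log 2 l') + t)))
        (Ψ (2 ^ (Nat.log 2 l - min (Nat.log 2 l) (Nat.log 2 l') + t)
           + l % 2 ^ (Nat.log 2 l - min (Nat.log 2 l) (Nat.log 2 l') + t)))
    else 0

/-! ### The inner product -/

theorem cinner_smul_smul (c c' : ℂ) (u v : E2) :
    cinner (c • u) (c' • v) = c * (starRingEnd ℂ) c' * cinner u v := by
  simp [cinner]; ring

theorem conj_cinner (u v : E2) : (starRingEnd ℂ) (cinner u v) = cinner v u := by
  simp [cinner]; ring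

theorem cinner_self (u : E2) : cinner u u = ((‖u‖ ^ 2 : ℝ) : ℂ) := by
  rw [EuclideanSpace.norm_sq_eq]
  simp [cinner, Complex.mul_conj']

theorem tsum_cinner_smul (c c' : ℂ) (f g : ℕ → E2) :
    ∑' k, cinner (c • f k) (c' • g k) = c * (starRingEnd ℂ) c' * ∑' k, cinner (f k) (g k) := by
  simp_rw [cinner_smul_smul]
  exact tsum_mul_left

theorem tsum_cinner_comm (f g : ℕ → E2) :
    ∑' k, cinner (f k) (g k) = (starRingEnd ℂ) (∑' k, cinner (g k) (f k)) := by
  rw [Complex.conj_tsum]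
  simp_rw [conj_cinner]

/-- Orthogonality of all shifts of `f` and `g`, from the two one-sided families. -/
theorem tsum_cinner_shift (f g : ℕ → E2) (c : ℂ)
    (hfg : ∀ m : ℕ, ∑' k, cinner (f (k + m)) (g k) = if m = 0 then c else 0)
    (hgf : ∀ m : ℕ, ∑' k, cinner (g (k + m)) (f k) = if m = 0 then (starRingEnd ℂ) c else 0)
    (σ : ℤ) :
    ∑' k : ℕ, cinner (f (k + (max 0 (-σ)).toNat)) (g (((k : ℤ) + (max 0 (-σ)).toNat + σ).toNat))
      = if σ = 0 then c else 0 := by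
  rcases le_total 0 σ with h | h
  · obtain ⟨n, rfl⟩ := Int.eq_ofNat_of_zero_le h
    have h0 : (max 0 (-(n : ℤ))).toNat = 0 := by omega
    have h1 : ∀ k : ℕ, ((k : ℤ) + ((0 : ℕ) : ℤ) + n).toNat = k + n := by intro k; omega
    simp_rw [h0, h1, add_zero]
    rw [tsum_cinner_comm, hgf]
    by_cases hn : n = 0 <;> simp [hn]
  · obtain ⟨n, hn⟩ := Int.eq_ofNat_of_zero_le (neg_nonneg.mpr h)
    obtain rfl : σ = -(n : ℤ) := by omega
    have h0 : (max 0 (- -(n : ℤ))).toNat = n := by omega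
    have h1 : ∀ k : ℕ, ((k : ℤ) + n + -(n : ℤ)).toNat = k := by intro k; omega
    simp_rw [h0, h1]
    rw [hfg]
    simp

/-! ### Binary expansions with the leading digit split off -/

theorem log_two_pow_add {m p : ℕ} (h : m < 2 ^ p) : Nat.log 2 (2 ^ p + m) = p := by
  rw [Nat.log_eq_iff (Or.inr ⟨by norm_num, by positivity⟩), pow_succ]
  omega

theorem size_eq_log_add_one {m : ℕ} (h : m ≠ 0) : Nat.size m = Nat.log 2 m + 1 := by
  apply le_antisymm
  · exact Nat.size_le.mpr (Nat.lt_pow_succ_log_self (by norm_num) m)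
  · exact Nat.lt_size.mpr (Nat.pow_log_le_self 2 h)

theorem lt_two_pow_size_add (m n : ℕ) : m < 2 ^ (Nat.size m + n) :=
  (Nat.lt_size_self m).trans_le (Nat.pow_le_pow_right (by norm_num) (by omega))

/-- The number `2 ^ (size m + n) + m`: the binary digits of `m`, preceded by `n` zeros and a
leading one. -/
def consOne (m n : ℕ) : ℕ := 2 ^ (Nat.size m + n) + m

theorem log_consOne (m n : ℕ) : Nat.log 2 (consOne m n) = Nat.size m + n :=
  log_two_pow_add (lt_two_pow_size_add m n)

theorem lt_consOne (m n : ℕ) : m < consOne m n :=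
  (lt_two_pow_size_add m n).trans_le (Nat.le_add_right _ _)

theorem consOne_mod (m n : ℕ) {s : ℕ} (hs : s ≤ Nat.size m + n) :
    consOne m n % 2 ^ s = m % 2 ^ s := by
  obtain ⟨t, ht⟩ := Nat.exists_eq_add_of_le hs
  rw [consOne, ht, pow_add, Nat.mul_add_mod]

theorem consOne_div (m n : ℕ) {s t : ℕ} (hs : Nat.size m + n = s + t) :
    consOne m n / 2 ^ s = 2 ^ t + m / 2 ^ s := by
  rw [consOne, hs, pow_add, Nat.mul_add_div (by positivity)]

theorem exists_eq_consOne {l : ℕ} (hl : l ≠ 0) : ∃ m n, l = consOne m n := by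
  have h1 := Nat.pow_log_le_self 2 hl
  have h2 := Nat.lt_pow_succ_log_self (b := 2) (by norm_num) l
  rw [pow_succ] at h2
  have h3 : Nat.size (l - 2 ^ Nat.log 2 l) ≤ Nat.log 2 l := Nat.size_le.mpr (by omega)
  refine ⟨l - 2 ^ Nat.log 2 l, Nat.log 2 l - Nat.size (l - 2 ^ Nat.log 2 l), ?_⟩
  rw [consOne, Nat.add_sub_cancel' h3]
  omega

theorem consOne_inj_left {m m' n : ℕ} : consOne m n = consOne m' n ↔ m = m' := by
  refine ⟨fun h => ?_, fun h => by rw [h]⟩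
  have hlog := log_consOne m n
  rw [h, log_consOne] at hlog
  simp only [consOne, hlog] at h
  omega

theorem consOne_eq_imp {m m' n n' : ℕ} (h : consOne m n = consOne m' n') :
    m = m' ∧ n = n' := by
  have hlog := log_consOne m n
  rw [h, log_consOne] at hlog
  simp only [consOne, hlog] at h
  obtain rfl : m = m' := by omega
  exact ⟨rfl, by omega⟩

/-! ### The Gram sum -/

/-- The contribution to `gramSum` of agreement of the `s + 1` leading binary digits. -/
noncomputable def gramTerm (Ψ : ℕ → E2) (l l' s : ℕ) : ℂ :=
  if l / 2 ^ (Nat.log 2 l - s) = l' / 2 ^ (Nat.log 2 l' - s) then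
    cinner (Ψ (2 ^ (Nat.log 2 l' - s) + l' % 2 ^ (Nat.log 2 l' - s)))
      (Ψ (2 ^ (Nat.log 2 l - s) + l % 2 ^ (Nat.log 2 l - s)))
  else 0

/-- The sum subtracted in `betaC`, indexed by the number of common leading binary digits. -/
noncomputable def gramSum (Ψ : ℕ → E2) (l l' : ℕ) : ℂ :=
  ∑ s ∈ Finset.range (min (Nat.log 2 l) (Nat.log 2 l') + 1), gramTerm Ψ l l' s

theorem betaC_eq_sub_gramSum (Ψ : ℕ → E2) (B : ℝ) {l l' : ℕ} (hl : l ≠ 0) (hl' : l' ≠ 0) :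
    betaC Ψ B l l' = (if l = l' then (B : ℂ) else 0) - gramSum Ψ l l' := by
  rw [gramSum, ← Finset.sum_range_reflect]
  by_cases h : l = l'
  · subst h
    simp only [betaC, hl, and_self, or_self, if_true, if_false, min_self]
    push_cast
    congr 1
    refine Finset.sum_congr rfl fun j hj => ?_
    rw [Finset.mem_range] at hj
    have hj' : Nat.log 2 l - (Nat.log 2 l - j) = j := by omega
    rw [gramTerm, hj', if_pos rfl, cinner_self]
    push_cast
    rfl
  · simp only [betaC, hl, hl', h, and_self, or_self, if_false, zero_sub]
    congr 1
    refine Finset.sum_congr rfl fun j hj => ?_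
    rw [Finset.mem_range] at hj
    have e : Nat.log 2 l - (min (Nat.log 2 l) (Nat.log 2 l') + 1 - 1 - j)
        = Nat.log 2 l - min (Nat.log 2 l) (Nat.log 2 l') + j := by omega
    have e' : Nat.log 2 l' - (min (Nat.log 2 l) (Nat.log 2 l') + 1 - 1 - j)
        = Nat.log 2 l' - min (Nat.log 2 l) (Nat.log 2 l') + j := by omega
    rw [gramTerm, e, e']

theorem hseq_eq (Ψ : ℕ → E2) (m n : ℕ) : hseq Ψ m n = Ψ (2 ^ (Nat.size m + n) + m) := by
  by_cases h : m = 0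
  · simp [hseq, h]
  · rw [hseq, if_neg h, size_eq_log_add_one h]
    congr 3
    ring

theorem consOne_div_of_le (m n : ℕ) {s : ℕ} (hs : s ≤ n) :
    consOne m n / 2 ^ (Nat.size m + n - s) = 2 ^ s := by
  rw [consOne_div m n (t := s) (by omega), Nat.div_eq_of_lt, add_zero]
  have := lt_two_pow_size_add m (n - s)
  rwa [← Nat.add_sub_assoc hs] at this

theorem consOne_div_size {m : ℕ} (hm : m ≠ 0) (n : ℕ) :
    consOne m n / 2 ^ (Nat.size m + n - (n + 1)) = 2 ^ (n + 1) + 1 := by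
  have hsz := size_eq_log_add_one hm
  rw [consOne_div m n (t := n + 1) (by omega)]
  have : Nat.size m + n - (n + 1) = Nat.log 2 m := by omega
  rw [this]
  congr 1
  rw [Nat.div_eq_iff (by positivity)]
  have h1 := Nat.pow_log_le_self 2 hm
  have h2 := Nat.lt_pow_succ_log_self (b := 2) (by norm_num) m
  rw [pow_succ] at h2
  omega

theorem gramTerm_of_le (Ψ : ℕ → E2) (m m' : ℕ) {n n' s : ℕ} (hs : s ≤ n) (hs' : s ≤ n') :
    gramTerm Ψ (consOne m n) (consOne m' n') s
      = cinner (hseq Ψ m' (n' - s)) (hseq Ψ m (n - s)) := by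
  have key : ∀ {m n : ℕ}, s ≤ n → 2 ^ (Nat.size m + n - s)
      + consOne m n % 2 ^ (Nat.size m + n - s) = 2 ^ (Nat.size m + (n - s)) + m := by
    intro m n h
    rw [consOne_mod m n (by omega), Nat.add_sub_assoc h,
      Nat.mod_eq_of_lt (lt_two_pow_size_add m (n - s))]
  rw [gramTerm, log_consOne, log_consOne, consOne_div_of_le m n hs, consOne_div_of_le m' n' hs',
    if_pos rfl, key hs, key hs', hseq_eq, hseq_eq]

/-- Agreement of leading digits passes to fewer leading digits. -/
theorem div_eq_div_of_le {l l' p p' s t : ℕ} (hp : s ≤ p) (hp' : s ≤ p') (hts : t ≤ s)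
    (h : l / 2 ^ (p - s) = l' / 2 ^ (p' - s)) : l / 2 ^ (p - t) = l' / 2 ^ (p' - t) := by
  have e : p - t = (p - s) + (s - t) := by omega
  have e' : p' - t = (p' - s) + (s - t) := by omega
  rw [e, e', pow_add, pow_add, ← Nat.div_div_eq_div_mul, ← Nat.div_div_eq_div_mul, h]

theorem gramTerm_eq_zero_of_lt (Ψ : ℕ → E2) {m m' n n' s : ℕ} (hnn : n ≠ n')
    (hs : min n n' < s) (h : s ≤ Nat.size m + n) (h' : s ≤ Nat.size m' + n') :
    gramTerm Ψ (consOne m n) (consOne m' n') s = 0 := by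
  rw [gramTerm, log_consOne, log_consOne, if_neg]
  intro heq
  have hd := div_eq_div_of_le (t := min n n' + 1) h h' hs heq
  rcases lt_or_gt_of_ne hnn with hlt | hlt
  · rw [min_eq_left hlt.le] at hd hs
    rw [consOne_div_of_le m' n' hlt, consOne_div_size (by rintro rfl; simp at h; omega)] at hd
    omega
  · rw [min_eq_right hlt.le] at hd hs
    rw [consOne_div_of_le m n hlt, consOne_div_size (by rintro rfl; simp at h'; omega)] at hd
    omega

theorem gramTerm_consOne_add (Ψ : ℕ → E2) {m m' : ℕ} (hm : m ≠ 0) (hm' : m' ≠ 0) (n : ℕ) {u : ℕ}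
    (hu : u ≤ Nat.log 2 m) (hu' : u ≤ Nat.log 2 m') :
    gramTerm Ψ (consOne m n) (consOne m' n) (n + 1 + u) = gramTerm Ψ m m' u := by
  have hsz := size_eq_log_add_one hm
  have hsz' := size_eq_log_add_one hm'
  have e : Nat.size m + n - (n + 1 + u) = Nat.log 2 m - u := by omega
  have e' : Nat.size m' + n - (n + 1 + u) = Nat.log 2 m' - u := by omega
  rw [gramTerm, gramTerm, log_consOne, log_consOne, e, e',
    consOne_div m n (t := n + 1 + u) (by omega), consOne_div m' n (t := n + 1 + u) (by omega),
    consOne_mod m n (by omega), consOne_mod m' n (by omega)]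
  simp only [Nat.add_left_cancel_iff]

theorem gramSum_consOne (Ψ : ℕ → E2) (m m' n n' : ℕ) :
    gramSum Ψ (consOne m n) (consOne m' n')
      = ∑ r ∈ Finset.range (min n n' + 1), cinner (hseq Ψ m' (n' - r)) (hseq Ψ m (n - r))
        + if n = n' ∧ m ≠ 0 ∧ m' ≠ 0 then gramSum Ψ m m' else 0 := by
  obtain ⟨t, ht⟩ : ∃ t, min (Nat.size m + n) (Nat.size m' + n') + 1 = min n n' + 1 + t :=
    Nat.exists_eq_add_of_le (by omega)
  rw [gramSum, log_consOne, log_consOne, ht, Finset.sum_range_add]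
  congr 1
  · refine Finset.sum_congr rfl fun s hs => ?_
    rw [Finset.mem_range] at hs
    exact gramTerm_of_le Ψ m m' (by omega) (by omega)
  · split_ifs with h
    · obtain ⟨rfl, hm, hm'⟩ := h
      have hsz := size_eq_log_add_one hm
      have hsz' := size_eq_log_add_one hm'
      obtain rfl : t = min (Nat.log 2 m) (Nat.log 2 m') + 1 := by omega
      refine Finset.sum_congr rfl fun u hu => ?_
      rw [Finset.mem_range] at hu
      rw [min_self]
      exact gramTerm_consOne_add Ψ hm hm' n (by omega) (by omega)
    · refine Finset.sum_eq_zero fun u hu => ?_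
      rw [Finset.mem_range] at hu
      by_cases hn : n = n'
      · subst hn
        have : m = 0 ∨ m' = 0 := by tauto
        rcases this with rfl | rfl <;> simp at ht <;> omega
      · exact gramTerm_eq_zero_of_lt Ψ hn (by omega) (by omega) (by omega)

/-! ### The rank-one kernel identity -/

/-- The sequence of which `h_m` is a multiple. -/
def baseSeq (a0 a1 : ℕ → E2) (m : ℕ) : ℕ → E2 := if m = 0 then a0 else a1

/-- The ratio of `C` at `consOne m n` to the coefficient of `h_m`. -/
noncomputable def weight (a0 a1 : ℕ → E2) (B₀ C₁ : ℂ) (m n : ℕ) : ℂ :=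
  if m = 0 ∧ n = 0 then C₁ / B₀
  else -((starRingEnd ℂ) B₀ / (starRingEnd ℂ) C₁) * cinner (baseSeq a0 a1 m n) (a0 0)

/-- The kernel identity expressing products of weights through truncated correlations. -/
def KernelIdentity (a0 a1 : ℕ → E2) (B₀ C₁ : ℂ) (m m' n n' : ℕ) : Prop :=
  weight a0 a1 B₀ C₁ m' n' * (starRingEnd ℂ) (weight a0 a1 B₀ C₁ m n)
    = (if (m = 0 ↔ m' = 0) ∧ n = n' then 1 else 0)
      - ∑ r ∈ Finset.range (min n n' + 1),
          cinner (baseSeq a0 a1 m' (n' - r)) (baseSeq a0 a1 m (n - r))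

theorem KernelIdentity.symm {a0 a1 : ℕ → E2} {B₀ C₁ : ℂ} {m m' n n' : ℕ}
    (h : KernelIdentity a0 a1 B₀ C₁ m m' n n') : KernelIdentity a0 a1 B₀ C₁ m' m n' n := by
  have h2 := congrArg (starRingEnd ℂ) h
  simp only [map_mul, map_sub, map_sum, conj_cinner, Complex.conj_conj, apply_ite (starRingEnd ℂ),
    map_one, map_zero] at h2
  rw [KernelIdentity, mul_comm, h2, min_comm]
  simp only [iff_comm, eq_comm]

theorem sum_cinner_self_reflect (a : ℕ → E2) (n : ℕ) :
    ∑ r ∈ Finset.range (n + 1), cinner (a (n - r)) (a (n - r))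
      = ((∑ k ∈ Finset.range (n + 1), ‖a k‖ ^ 2 : ℝ) : ℂ) := by
  rw [← Finset.sum_range_reflect, Complex.ofReal_sum]
  refine Finset.sum_congr rfl fun r hr => ?_
  rw [Finset.mem_range] at hr
  rw [cinner_self, Nat.add_sub_cancel, Nat.sub_sub_self (by omega)]

theorem kernelIdentity {a0 a1 : ℕ → E2} (hC : condC a0 a1) {B₀ C₁ : ℂ} (hB₀ : B₀ ≠ 0)
    (hC₁ : ‖C₁‖ ^ 2 = ‖B₀‖ ^ 2 * (1 - ‖a0 0‖ ^ 2)) (hC₁ne : C₁ ≠ 0) (m m' n n' : ℕ) :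
    KernelIdentity a0 a1 B₀ C₁ m m' n n' := by
  obtain ⟨c1, c2, c3, c4, c5, c6⟩ := hC
  have hcB : (starRingEnd ℂ) B₀ ≠ 0 := by simpa using hB₀
  have hcC : (starRingEnd ℂ) C₁ ≠ 0 := by simpa using hC₁ne
  have hCC : C₁ * (starRingEnd ℂ) C₁
      = B₀ * (starRingEnd ℂ) B₀ * ((1 - ‖a0 0‖ ^ 2 : ℝ) : ℂ) := by
    rw [Complex.mul_conj', Complex.mul_conj']
    exact_mod_cast hC₁
  have hd : ((1 - ‖a0 0‖ ^ 2 : ℝ) : ℂ) ≠ 0 := by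
    intro h
    rw [h, mul_zero] at hCC
    exact mul_ne_zero hC₁ne hcC hCC
  set d : ℂ := ((1 - ‖a0 0‖ ^ 2 : ℝ) : ℂ) with hddef
  -- both weights are correlations with `a0 0`
  have generic : ∀ {x y S : ℂ}, x * (starRingEnd ℂ) y = d * S →
      (-((starRingEnd ℂ) B₀ / (starRingEnd ℂ) C₁) * x) *
        (starRingEnd ℂ) (-((starRingEnd ℂ) B₀ / (starRingEnd ℂ) C₁) * y) = S := by
    intro x y S h
    simp only [map_mul, map_neg, map_div₀, Complex.conj_conj]
    have e : -((starRingEnd ℂ) B₀ / (starRingEnd ℂ) C₁) * x * (-(B₀ / C₁) * (starRingEnd ℂ) y)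
        = (B₀ * (starRingEnd ℂ) B₀) * (x * (starRingEnd ℂ) y) / (C₁ * (starRingEnd ℂ) C₁) := by
      field_simp
    rw [e, h, hCC]
    field_simp
  have diag : ∀ {x : ℂ} {s : ℝ}, ‖x‖ ^ 2 = (1 - ‖a0 0‖ ^ 2) * (1 - s) →
      x * (starRingEnd ℂ) x = d * (1 - (s : ℂ)) := by
    intro x s h
    rw [Complex.mul_conj', hddef]
    exact_mod_cast h
  -- the weight at `(0, 0)` against any other one
  have exceptional : ∀ x : ℂ, (-((starRingEnd ℂ) B₀ / (starRingEnd ℂ) C₁) * x) *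
      (starRingEnd ℂ) (C₁ / B₀) = -x := by
    intro x
    rw [map_div₀]
    field_simp
  have k00 : ∀ n n', n ≤ n' → KernelIdentity a0 a1 B₀ C₁ 0 0 n n' := by
    intro n n' hn
    rcases Nat.eq_zero_or_pos n with rfl | hpos
    · rcases Nat.eq_zero_or_pos n' with rfl | hpos'
      · simp only [KernelIdentity, weight, baseSeq, and_self, if_true, min_self, zero_add,
          Finset.sum_range_one, cinner_self, map_div₀]
        rw [div_mul_div_comm, hCC, mul_div_cancel_left₀ _ (mul_ne_zero hB₀ hcB), hddef]
        push_cast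
        rfl
      · simp only [KernelIdentity, weight, baseSeq, hpos'.ne', hpos'.ne, and_false, and_self,
          if_true, if_false, exceptional]
        simp
    · have hpos' : n' ≠ 0 := by omega
      simp only [KernelIdentity, weight, baseSeq, if_true, hpos.ne', hpos', and_false, if_false,
        true_and]
      apply generic
      rcases hn.eq_or_lt with rfl | hlt
      · rw [if_pos rfl, min_self, sum_cinner_self_reflect]
        exact diag (c1 n hpos)
      · rw [if_neg hlt.ne, min_eq_left hn, conj_cinner, c3 n n' hpos hlt]
        ring
  have k11 : ∀ n n', n ≤ n' → KernelIdentity a0 a1 B₀ C₁ 1 1 n n' := by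
    intro n n' hn
    simp only [KernelIdentity, weight, baseSeq, one_ne_zero, false_and, if_false, true_and]
    apply generic
    rcases hn.eq_or_lt with rfl | hlt
    · rw [if_pos rfl, min_self, sum_cinner_self_reflect]
      exact diag (c2 n)
    · rw [if_neg hlt.ne, min_eq_left hn, conj_cinner, c4 n n' hlt]
      ring
  have k01 : ∀ n n', KernelIdentity a0 a1 B₀ C₁ 0 1 n n' := by
    intro n n'
    rcases Nat.eq_zero_or_pos n with rfl | hpos
    · simp only [KernelIdentity, weight, baseSeq, one_ne_zero, false_and, and_self, if_true,
        if_false, exceptional]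
      simp
    · simp only [KernelIdentity, weight, baseSeq, one_ne_zero, false_and, if_false, if_true,
        hpos.ne', and_false, iff_false, not_true_eq_false]
      apply generic
      rw [conj_cinner]
      rcases le_or_gt n n' with hle | hlt
      · rw [min_eq_left hle, c5 n n' hpos hle]
        ring
      · rw [min_eq_right hlt.le, c6 n n' hlt]
        ring
  have congr_selector : ∀ {i i' j j' : ℕ}, (i = 0 ↔ j = 0) → (i' = 0 ↔ j' = 0) →
      KernelIdentity a0 a1 B₀ C₁ i i' n n' → KernelIdentity a0 a1 B₀ C₁ j j' n n' := by
    intro i i' j j' hi hi' h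
    simpa only [KernelIdentity, weight, baseSeq, hi, hi'] using h
  by_cases hm : m = 0 <;> by_cases hm' : m' = 0
  · refine congr_selector (i := 0) (i' := 0) (by simp [hm]) (by simp [hm']) ?_
    rcases le_total n n' with h | h
    · exact k00 n n' h
    · exact (k00 n' n h).symm
  · exact congr_selector (i := 0) (i' := 1) (by simp [hm]) (by simp [hm']) (k01 n n')
  · exact congr_selector (i := 1) (i' := 0) (by simp [hm]) (by simp [hm']) (k01 n' n).symm
  · refine congr_selector (i := 1) (i' := 1) (by simp [hm]) (by simp [hm']) ?_
    rcases le_total n n' with h | h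
    · exact k11 n n' h
    · exact (k11 n' n h).symm

/-! ### Factorization of `β` -/

/-- If `h_m` is `D m` times the base sequence and `D` is multiplicative along `consOne`, then
`β` factors as a rank-one kernel. -/
theorem mul_conj_eq_sub_gramSum {a0 a1 : ℕ → E2} {B₀ C₁ : ℂ} {B : ℝ} (hB : ‖B₀‖ ^ 2 = B)
    (hK : ∀ m m' n n', KernelIdentity a0 a1 B₀ C₁ m m' n n') {Ψ : ℕ → E2} {D : ℕ → ℂ}
    (hD0 : D 0 = B₀) (hD : ∀ m n, D (consOne m n) = D m * weight a0 a1 B₀ C₁ m n)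
    (hΨ : ∀ m n, hseq Ψ m n = D m • baseSeq a0 a1 m n) (l : ℕ) :
    ∀ l', l ≠ 0 → l' ≠ 0 →
      D l' * (starRingEnd ℂ) (D l) = (if l = l' then (B : ℂ) else 0) - gramSum Ψ l l' := by
  induction l using Nat.strong_induction_on with
  | _ l ih =>
  intro l' hl hl'
  obtain ⟨m, n, rfl⟩ := exists_eq_consOne hl
  obtain ⟨m', n', rfl⟩ := exists_eq_consOne hl'
  have hBB : B₀ * (starRingEnd ℂ) B₀ = (B : ℂ) := by
    rw [Complex.mul_conj', ← hB]
    push_cast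
    rfl
  have hk : D (consOne m' n') * (starRingEnd ℂ) (D (consOne m n))
      = D m' * (starRingEnd ℂ) (D m) * (weight a0 a1 B₀ C₁ m' n' *
          (starRingEnd ℂ) (weight a0 a1 B₀ C₁ m n)) := by
    rw [hD, hD, map_mul]
    ring
  rw [hk, hK m m' n n', gramSum_consOne, mul_sub, Finset.mul_sum]
  simp only [hΨ, cinner_smul_smul]
  rw [← sub_sub, sub_right_comm]
  congr 1
  by_cases hn : n = n'
  · subst hn
    rw [if_congr consOne_inj_left rfl rfl]
    by_cases hm : m = 0 <;> by_cases hm' : m' = 0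
    · simp [hm, hm', hD0, hBB]
    · simp [hm, hm', Ne.symm hm']
    · simp [hm, hm']
    · have := ih m (lt_consOne m n) m' hm hm'
      simp [hm, hm', this]
  · have hne : consOne m n ≠ consOne m' n' := fun h => hn (consOne_eq_imp h).2
    simp [hn, hne]

/-- Correlations of the base sequences under condition (A). -/
theorem condA.tsum_baseSeq {a0 a1 : ℕ → E2} (hA : condA a0 a1) (l l' m : ℕ) :
    ∑' k, cinner (baseSeq a0 a1 l' (k + m)) (baseSeq a0 a1 l k)
      = if m = 0 then (if l = 0 ↔ l' = 0 then 1 else 0) else 0 := by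
  obtain ⟨h00, h11, h01, h10⟩ := hA
  by_cases hl : l = 0 <;> by_cases hl' : l' = 0
  · simp [baseSeq, hl, hl', h00]
  · simp [baseSeq, hl, hl', h10]
  · simp [baseSeq, hl, hl', h01]
  · simp [baseSeq, hl, hl', h11]

theorem stmt7 (a0 a1 : ℕ → E2) (hA : condA a0 a1) (hC : condC a0 a1)
    (ha00 : ‖a0 0‖ < 1)
    (B : ℝ) (hB : 0 < B) (B₀ C₁ : ℂ) (hB₀ : ‖B₀‖ ^ 2 = B)
    (hC₁ : ‖C₁‖ ^ 2 = B * (1 - ‖a0 0‖ ^ 2)) (hC₁ne : C₁ ≠ 0)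
    (C : ℕ → ℂ)
    (hC1 : C 1 = C₁)
    (hC2k : ∀ k : ℕ, 1 ≤ k →
      C (2 ^ k) = -((B : ℂ) / (starRingEnd ℂ) C₁) * cinner (a0 k) (a0 0))
    (hC2k1 : ∀ k : ℕ, 1 ≤ k →
      C (2 ^ k + 1) = -(C₁ * (starRingEnd ℂ) B₀ / (starRingEnd ℂ) C₁) *
        cinner (a1 (k - 1)) (a0 0))
    (hCrec : ∀ l : ℕ, 2 ≤ l → 2 ≤ l % 2 ^ Nat.log 2 l →
      C l = C (2 ^ (Nat.log 2 l - Nat.log 2 (l % 2 ^ Nat.log 2 l)) + 1) *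
              C (l % 2 ^ Nat.log 2 l) / C₁)
    (Ψ : ℕ → E2)
    (hΨ0 : Ψ 0 = 0)
    (hΨ2k : ∀ k : ℕ, Ψ (2 ^ k) = B₀ • a0 k)
    (hΨl : ∀ l : ℕ, 1 ≤ l → ∀ k : ℕ,
      Ψ (2 ^ (Nat.log 2 l + k + 1) + l) = C l • a1 k) :
    ∀ l l' : ℕ, ∀ σ : ℤ,
      (∑' k : ℕ,
        cinner (hseq Ψ l' (k + (max 0 (-σ)).toNat))
               (hseq Ψ l (((k : ℤ) + (max 0 (-σ)).toNat + σ).toNat)))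
        = if σ = 0 then betaC Ψ B l l' else 0 := by
  have hB₀ne : B₀ ≠ 0 := by
    rintro rfl
    simp at hB₀
    exact hB.ne hB₀
  have hBB : (B : ℂ) = B₀ * (starRingEnd ℂ) B₀ := by
    rw [Complex.mul_conj', ← hB₀]
    push_cast
    rfl
  have hK := kernelIdentity hC hB₀ne (by rw [hB₀]; exact hC₁) hC₁ne
  let D : ℕ → ℂ := fun l => if l = 0 then B₀ else C l
  have hD0 : D 0 = B₀ := if_pos rfl
  have hDpos : ∀ {l}, l ≠ 0 → D l = C l := fun h => if_neg h
  have hΨ : ∀ m n, hseq Ψ m n = D m • baseSeq a0 a1 m n := by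
    intro m n
    by_cases hm : m = 0
    · simp [hm, hseq, baseSeq, hD0, hΨ2k]
    · simp [hm, hseq, baseSeq, hDpos hm, hΨl m (Nat.one_le_iff_ne_zero.mpr hm) n]
  have hCone : ∀ n, C (2 ^ (n + 1) + 1) = C₁ * weight a0 a1 B₀ C₁ 1 n := by
    intro n
    rw [hC2k1 (n + 1) (by omega)]
    simp [weight, baseSeq]
    ring
  have hD : ∀ m n, D (consOne m n) = D m * weight a0 a1 B₀ C₁ m n := by
    intro m n
    rw [hDpos (Nat.ne_zero_of_lt (lt_consOne m n))]
    rcases Nat.eq_zero_or_pos m with rfl | hm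
    · rcases Nat.eq_zero_or_pos n with rfl | hn
      · simp only [consOne, weight, hD0, Nat.size_zero, and_self, if_true]
        rw [mul_div_cancel₀ _ hB₀ne]
        simpa using hC1
      · simp only [consOne, Nat.size_zero, zero_add, add_zero, hC2k n hn, hD0, weight, baseSeq,
          hn.ne', and_false, if_false, if_true, hBB]
        ring
    · rw [hDpos hm.ne']
      rcases (Nat.succ_le_of_lt hm).eq_or_lt with h1 | h2
      · obtain rfl : m = 1 := h1.symm
        rw [hC1, ← hCone, consOne, Nat.size_one, add_comm 1 n]
      · have hmod : consOne m n % 2 ^ Nat.log 2 (consOne m n) = m := by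
          rw [log_consOne, consOne_mod m n le_rfl, Nat.mod_eq_of_lt (lt_two_pow_size_add m n)]
        have hrec := hCrec (consOne m n) (by have := lt_consOne m n; omega) (by rw [hmod]; omega)
        have he : Nat.size m + n - Nat.log 2 m = n + 1 := by
          have := size_eq_log_add_one hm.ne'
          omega
        have hw : weight a0 a1 B₀ C₁ 1 n = weight a0 a1 B₀ C₁ m n := by
          simp [weight, baseSeq, hm.ne']
        rw [hmod, log_consOne, he, hCone, hw] at hrec
        rw [hrec]
        field_simp
  intro l l' σ
  simp_rw [hΨ]
  rw [tsum_cinner_smul, tsum_cinner_shift _ _ (if l = 0 ↔ l' = 0 then 1 else 0)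
    (hA.tsum_baseSeq l l') (fun m => by
      rw [hA.tsum_baseSeq l' l m, apply_ite (starRingEnd ℂ), map_one, map_zero]
      simp only [iff_comm]) σ]
  by_cases hσ : σ = 0
  · simp only [hσ, if_true]
    by_cases hl : l = 0 <;> by_cases hl' : l' = 0
    · simp [hl, hl', hD0, betaC, hBB]
    · simp [hl, hl', betaC]
    · simp [hl, hl', betaC]
    · rw [betaC_eq_sub_gramSum Ψ B hl hl',
        ← mul_conj_eq_sub_gramSum hB₀ hK hD0 hD hΨ l l' hl hl']
      simp [hl, hl']
  · simp [hσ]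
end

section
/- Let u₀,u₁ be an orthonormal basis of ℂ², let 0 < ρ < 1 and θ ∈ ℝ. Define a⁰,a¹ : ℕ → ℂ² by a⁰₀ := ρ·u₀, a⁰₁ := √(1−ρ²)·u₁, a⁰_k := 0 for k ≥ 2, a¹₀ := e^{iθ}√(1−ρ²)·u₀, a¹₁ := −e^{iθ}ρ·u₁, a¹_k := 0 for k ≥ 2 (the Type 3 family). Then a⁰,a¹ satisfy condition (A) and conditions (C1)–(C5). -/
open Finset

theorem cinner_eq_inner (u v : E2) : cinner u v = inner ℂ v u := by
  simp [cinner, PiLp.inner_apply]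

/-- The sequence `c₀ u₀, c₁ u₁, 0, 0, …`. -/
def IsTwoStep (u0 u1 : E2) (c0 c1 : ℂ) (a : ℕ → E2) : Prop :=
  a 0 = c0 • u0 ∧ a 1 = c1 • u1 ∧ ∀ k, 2 ≤ k → a k = 0

namespace IsTwoStep

variable {u0 u1 : E2} {c0 c1 e0 e1 : ℂ} {a b : ℕ → E2}

theorem cinner_of_ne (ha : IsTwoStep u0 u1 c0 c1 a) (hb : IsTwoStep u0 u1 e0 e1 b)
    (horth : cinner u0 u1 = 0) {i j : ℕ} (hij : i ≠ j) : cinner (a i) (b j) = 0 := by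
  obtain ⟨ha0, ha1, hak⟩ := ha
  obtain ⟨hb0, hb1, hbk⟩ := hb
  have horth' : inner ℂ u0 u1 = 0 := by
    rw [← inner_eq_zero_symm, ← cinner_eq_inner, horth]
  rw [cinner_eq_inner] at horth ⊢
  rcases i with _ | _ | i <;> rcases j with _ | _ | j <;>
    simp_all

theorem cinner_zero (ha : IsTwoStep u0 u1 c0 c1 a) (hb : IsTwoStep u0 u1 e0 e1 b)
    (hu0 : ‖u0‖ = 1) : cinner (a 0) (b 0) = c0 * (starRingEnd ℂ) e0 := by
  rw [cinner_eq_inner, ha.1, hb.1, inner_smul_left, inner_smul_right,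
    inner_self_eq_norm_sq_to_K, hu0]
  simp [mul_comm]

theorem cinner_one (ha : IsTwoStep u0 u1 c0 c1 a) (hb : IsTwoStep u0 u1 e0 e1 b)
    (hu1 : ‖u1‖ = 1) : cinner (a 1) (b 1) = c1 * (starRingEnd ℂ) e1 := by
  rw [cinner_eq_inner, ha.2.1, hb.2.1, inner_smul_left, inner_smul_right,
    inner_self_eq_norm_sq_to_K, hu1]
  simp [mul_comm]

theorem cinner_of_two_le (ha : IsTwoStep u0 u1 c0 c1 a) {k : ℕ} (hk : 2 ≤ k) (v : E2) :
    cinner (a k) v = 0 := by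
  simp [cinner_eq_inner, ha.2.2 k hk]

theorem tsum_cinner (ha : IsTwoStep u0 u1 c0 c1 a) (hb : IsTwoStep u0 u1 e0 e1 b)
    (hu0 : ‖u0‖ = 1) (hu1 : ‖u1‖ = 1) (horth : cinner u0 u1 = 0) (m : ℕ) :
    ∑' k, cinner (a (k + m)) (b k) =
      if m = 0 then c0 * (starRingEnd ℂ) e0 + c1 * (starRingEnd ℂ) e1 else 0 := by
  split_ifs with hm
  · subst hm
    rw [tsum_eq_sum (s := range 2) fun k hk =>
      ha.cinner_of_two_le (by simpa [Nat.succ_le_iff] using hk) _]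
    simp [sum_range_succ, ha.cinner_zero hb hu0, ha.cinner_one hb hu1]
  · simp [fun k => ha.cinner_of_ne hb horth (show k + m ≠ k by omega)]

theorem sum_cinner_of_ne (ha : IsTwoStep u0 u1 c0 c1 a) (hb : IsTwoStep u0 u1 e0 e1 b)
    (horth : cinner u0 u1 = 0) {p p' n : ℕ} (hp : n ≤ p) (hp' : n ≤ p') (hne : p' ≠ p) :
    ∑ r ∈ range (n + 1), cinner (a (p' - r)) (b (p - r)) = 0 :=
  sum_eq_zero fun r hr => ha.cinner_of_ne hb horth (by have := mem_range.1 hr; omega)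

theorem sum_cinner_self (ha : IsTwoStep u0 u1 c0 c1 a) (hb : IsTwoStep u0 u1 e0 e1 b)
    (hu0 : ‖u0‖ = 1) (hu1 : ‖u1‖ = 1) {p : ℕ} (hp : 0 < p) :
    ∑ r ∈ range (p + 1), cinner (a (p - r)) (b (p - r)) =
      c0 * (starRingEnd ℂ) e0 + c1 * (starRingEnd ℂ) e1 := by
  rw [sum_flip fun k => cinner (a k) (b k),
    ← sum_subset (range_subset_range.2 (show 2 ≤ p + 1 by omega)) fun k _ hk =>
      ha.cinner_of_two_le (by simpa [Nat.succ_le_iff] using hk) _]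
  simp [sum_range_succ, ha.cinner_zero hb hu0, ha.cinner_one hb hu1]

theorem norm_zero (ha : IsTwoStep u0 u1 c0 c1 a) (hu0 : ‖u0‖ = 1) : ‖a 0‖ = ‖c0‖ := by
  rw [ha.1, norm_smul, hu0, mul_one]

theorem sum_norm_sq (ha : IsTwoStep u0 u1 c0 c1 a) (hu0 : ‖u0‖ = 1) (hu1 : ‖u1‖ = 1)
    {p : ℕ} (hp : 0 < p) :
    ∑ k ∈ range (p + 1), ‖a k‖ ^ 2 = ‖c0‖ ^ 2 + ‖c1‖ ^ 2 := by
  rw [← sum_subset (range_subset_range.2 (show 2 ≤ p + 1 by omega)) fun k _ hk => by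
    simp [ha.2.2 k (by simpa [Nat.succ_le_iff] using hk)]]
  simp [sum_range_succ, ha.1, ha.2.1, norm_smul, hu0, hu1]

/-- Two-step sequences whose coefficient vectors are orthonormal satisfy condition (A). -/
theorem condA (ha : IsTwoStep u0 u1 c0 c1 a) (hb : IsTwoStep u0 u1 e0 e1 b)
    (hu0 : ‖u0‖ = 1) (hu1 : ‖u1‖ = 1) (horth : cinner u0 u1 = 0)
    (hc : ‖c0‖ ^ 2 + ‖c1‖ ^ 2 = 1) (he : ‖e0‖ ^ 2 + ‖e1‖ ^ 2 = 1)
    (hce : e0 * (starRingEnd ℂ) c0 + e1 * (starRingEnd ℂ) c1 = 0) : condA a b := by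
  have hec : c0 * (starRingEnd ℂ) e0 + c1 * (starRingEnd ℂ) e1 = 0 := by
    simpa [mul_comm] using congrArg (starRingEnd ℂ) hce
  refine ⟨fun m => ?_, fun m => ?_, fun m => ?_, fun m => ?_⟩
  · rw [ha.tsum_cinner ha hu0 hu1 horth, Complex.mul_conj', Complex.mul_conj']
    norm_cast
    rw [hc]
    simp
  · rw [hb.tsum_cinner hb hu0 hu1 horth, Complex.mul_conj', Complex.mul_conj']
    norm_cast
    rw [he]
    simp
  · rw [ha.tsum_cinner hb hu0 hu1 horth, hec, ite_self]
  · rw [hb.tsum_cinner ha hu0 hu1 horth, hce, ite_self]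

/-- Two-step sequences whose coefficients form a unitary matrix satisfy (C1)–(C5). -/
theorem condC (ha : IsTwoStep u0 u1 c0 c1 a) (hb : IsTwoStep u0 u1 e0 e1 b)
    (hu0 : ‖u0‖ = 1) (hu1 : ‖u1‖ = 1) (horth : cinner u0 u1 = 0)
    (hc : ‖c0‖ ^ 2 + ‖c1‖ ^ 2 = 1) (he : ‖e0‖ ^ 2 + ‖e1‖ ^ 2 = 1)
    (hce : e0 * (starRingEnd ℂ) c0 + e1 * (starRingEnd ℂ) c1 = 0)
    (hrow : ‖c0‖ ^ 2 + ‖e0‖ ^ 2 = 1) : condC a b := by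
  refine ⟨fun p hp => ?_, fun p => ?_, fun p p' hp hpp' => ?_, fun p p' hpp' => ?_,
    fun p p' hp hpp' => ?_, fun p p' hpp' => ?_⟩
  · rw [ha.cinner_of_ne ha horth (by omega), ha.sum_norm_sq hu0 hu1 hp, hc]
    simp
  · rcases p.eq_zero_or_pos with rfl | hp
    · rw [hb.cinner_zero ha hu0, norm_mul, RCLike.norm_conj, zero_add, sum_range_one,
        ha.norm_zero hu0, hb.norm_zero hu0, mul_pow]
      linear_combination hrow
    · rw [hb.cinner_of_ne ha horth (by omega), hb.sum_norm_sq hu0 hu1 hp, he]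
      simp
  · rw [ha.cinner_of_ne ha horth (by omega), ha.sum_cinner_of_ne ha horth le_rfl hpp'.le hpp'.ne']
    simp
  · rw [hb.cinner_of_ne ha horth (by omega), hb.sum_cinner_of_ne hb horth le_rfl hpp'.le hpp'.ne']
    simp
  · rw [ha.cinner_of_ne ha horth hp.ne]
    rcases hpp'.eq_or_lt with rfl | hlt
    · rw [hb.sum_cinner_self ha hu0 hu1 hp, hce]
      simp
    · rw [hb.sum_cinner_of_ne ha horth le_rfl hpp' hlt.ne']
      simp
  · rw [ha.cinner_of_ne ha horth (by omega), hb.sum_cinner_of_ne ha horth hpp'.le le_rfl hpp'.ne]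
    simp

end IsTwoStep

theorem stmt17 (u0 u1 : E2) (hu0 : ‖u0‖ = 1) (hu1 : ‖u1‖ = 1)
    (horth : cinner u0 u1 = 0)
    (ρ θ : ℝ) (hρ0 : 0 < ρ) (hρ1 : ρ < 1)
    (a0 a1 : ℕ → E2)
    (ha00 : a0 0 = (ρ : ℂ) • u0)
    (ha01 : a0 1 = ((Real.sqrt (1 - ρ ^ 2) : ℝ) : ℂ) • u1)
    (ha0k : ∀ k : ℕ, 2 ≤ k → a0 k = 0)
    (ha10 : a1 0 = (Complex.exp ((θ : ℂ) * Complex.I) *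
      ((Real.sqrt (1 - ρ ^ 2) : ℝ) : ℂ)) • u0)
    (ha11 : a1 1 = (-(Complex.exp ((θ : ℂ) * Complex.I)) * (ρ : ℂ)) • u1)
    (ha1k : ∀ k : ℕ, 2 ≤ k → a1 k = 0) :
    condA a0 a1 ∧ condC a0 a1 := by
  have hs : Real.sqrt (1 - ρ ^ 2) ^ 2 = 1 - ρ ^ 2 := Real.sq_sqrt (by nlinarith)
  have ha : IsTwoStep u0 u1 _ _ a0 := ⟨ha00, ha01, ha0k⟩
  have hb : IsTwoStep u0 u1 _ _ a1 := ⟨ha10, ha11, ha1k⟩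
  have hc : ‖(ρ : ℂ)‖ ^ 2 + ‖((Real.sqrt (1 - ρ ^ 2) : ℝ) : ℂ)‖ ^ 2 = 1 := by
    simp only [Complex.norm_real, Real.norm_eq_abs, sq_abs, hs]
    ring
  have he : ‖Complex.exp ((θ : ℂ) * Complex.I) * ((Real.sqrt (1 - ρ ^ 2) : ℝ) : ℂ)‖ ^ 2 +
      ‖-(Complex.exp ((θ : ℂ) * Complex.I)) * (ρ : ℂ)‖ ^ 2 = 1 := by
    simp only [norm_mul, norm_neg, Complex.norm_exp_ofReal_mul_I, one_mul]
    rw [add_comm, hc]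
  have hce : Complex.exp ((θ : ℂ) * Complex.I) * ((Real.sqrt (1 - ρ ^ 2) : ℝ) : ℂ) *
      (starRingEnd ℂ) (ρ : ℂ) + -(Complex.exp ((θ : ℂ) * Complex.I)) * (ρ : ℂ) *
      (starRingEnd ℂ) ((Real.sqrt (1 - ρ ^ 2) : ℝ) : ℂ) = 0 := by
    rw [Complex.conj_ofReal, Complex.conj_ofReal]
    ring
  have hrow : ‖(ρ : ℂ)‖ ^ 2 +
      ‖Complex.exp ((θ : ℂ) * Complex.I) * ((Real.sqrt (1 - ρ ^ 2) : ℝ) : ℂ)‖ ^ 2 = 1 := by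
    rw [norm_mul, Complex.norm_exp_ofReal_mul_I, one_mul, hc]
  exact ⟨ha.condA hb hu0 hu1 horth hc he hce, ha.condC hb hu0 hu1 horth hc he hce hrow⟩
end
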